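/- There is no 4-GDD of type 2^6 5^1. -/

import Mathlib

open Finset

/-- `IsGDD k L` asserts the existence of a group divisible design with all
blocks of size `k` whose group sizes are listed in `L`: the point set is
`Fin L.sum`, the map `grp` assigns each point its group, group `i` has
exactly `L.get i` points, the block set `B` is a nonempty collection of
`k`-element subsets of the points, every pair of points from distinct groups
lies in exactly one block, and no block contains two distinct points of the
same group. -/
def IsGDD (k : ℕ) (L : List ℕ) : Prop :=
  ∃ (grp : Fin L.sum → Fin L.length) (B : Finset (Finset (Fin L.sum))),
    B.Nonempty ∧
    (∀ i : Fin L.length, (Finset.univ.filter fun x => grp x = i).card = L.get i) ∧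
    (∀ b ∈ B, b.card = k) ∧
    (∀ x y : Fin L.sum, grp x ≠ grp y → ∃! b, b ∈ B ∧ x ∈ b ∧ y ∈ b) ∧
    (∀ x y : Fin L.sum, x ≠ y → grp x = grp y → ∀ b ∈ B, x ∈ b → y ∉ b)

/-- All ways of writing a symbol in each of the listed cells such that no cell receives its own row
index and two cells sharing a row or a column receive different symbols. -/
def frameFillings : List (Fin 4 × Fin 4) → List (List (Fin 4))
  | [] => [[]]
  | p :: ps => (frameFillings ps).flatMap fun w =>
      ((List.finRange 4).filter fun a =>
        decide (a ≠ p.1 ∧ ∀ q ∈ ps.zip w, (q.1.1 = p.1 ∨ q.1.2 = p.2) → q.2 ≠ a)).map (· :: w)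

/-- The off-diagonal cells of a `4 × 4` array. -/
def offDiagCells : List (Fin 4 × Fin 4) :=
  [(0, 1), (0, 2), (0, 3), (1, 0), (1, 2), (1, 3), (2, 0), (2, 1), (2, 3), (3, 0), (3, 1), (3, 2)]

theorem map_mem_frameFillings (c : Fin 4 × Fin 4 → Fin 4) (ps : List (Fin 4 × Fin 4))
    (hnodup : ps.Nodup) (hrow : ∀ p ∈ ps, c p ≠ p.1)
    (hne : ∀ p ∈ ps, ∀ q ∈ ps, p ≠ q → (q.1 = p.1 ∨ q.2 = p.2) → c q ≠ c p) :
    ps.map c ∈ frameFillings ps := by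
  induction ps with
  | nil => simp [frameFillings]
  | cons p ps ih =>
    rw [List.nodup_cons] at hnodup
    have hps := ih hnodup.2 (fun q hq => hrow q (List.mem_cons_of_mem _ hq))
      (fun q hq r hr => hne q (List.mem_cons_of_mem _ hq) r (List.mem_cons_of_mem _ hr))
    simp only [frameFillings, List.mem_flatMap, List.mem_map, List.mem_filter, decide_eq_true_eq]
    refine ⟨ps.map c, hps, c p, ⟨List.mem_finRange _, hrow p (by simp), ?_⟩, by simp⟩
    intro q hq hpq
    rw [List.zip_map_right, List.mem_map] at hq
    obtain ⟨⟨r, s⟩, hrs, rfl⟩ := hq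
    obtain ⟨hr, hrs⟩ : r ∈ ps ∧ r = s := by
      have := List.of_mem_zip hrs
      refine ⟨this.1, ?_⟩
      rw [List.zip_eq_zipWith, List.zipWith_self, List.mem_map] at hrs
      grind
    subst hrs
    exact hne p (by simp) r (by simp [hr]) (by grind) hpq

theorem frameFillings_no_orthogonal_triple :
    ∀ u ∈ frameFillings offDiagCells, ∀ v ∈ frameFillings offDiagCells, (u.zip v).Nodup →
      ∀ w ∈ frameFillings offDiagCells, (u.zip w).Nodup → ¬ (v.zip w).Nodup := by
  decide +kernel

/-- There are no twelve words of length five over four symbols that pairwise agree in at most one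
coordinate and in each of which the first symbol is not repeated. -/
theorem no_twelve_words {X : Type*} [Fintype X] (hX : Fintype.card X = 12)
    (w : X → Fin 5 → Fin 4) (hfirst : ∀ x a, a ≠ 0 → w x a ≠ w x 0)
    (hagree : ∀ x y, x ≠ y → ∀ a b, a ≠ b → w x a = w y a → w x b ≠ w y b) : False := by
  classical
  let φ : X → {p : Fin 4 × Fin 4 // p.1 ≠ p.2} :=
    fun x => ⟨(w x 0, w x 1), (hfirst x 1 (by decide)).symm⟩
  have hinj : Function.Injective φ := by
    intro x y hxy
    by_contra hne
    simp only [φ, Subtype.mk.injEq, Prod.mk.injEq] at hxy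
    exact hagree x y hne 0 1 (by decide) hxy.1 hxy.2
  have hsurj : Function.Surjective φ := by
    refine ((Fintype.bijective_iff_injective_and_card φ).2 ⟨hinj, ?_⟩).2
    rw [hX]
    decide
  have hcell : ∀ p ∈ offDiagCells, p.1 ≠ p.2 := by decide
  have hnodup : offDiagCells.Nodup := by decide
  have hex : ∀ p : Fin 4 × Fin 4, ∃ x, p.1 ≠ p.2 → w x 0 = p.1 ∧ w x 1 = p.2 := by
    intro p
    by_cases hp : p.1 = p.2
    · obtain ⟨x, -⟩ := hsurj ⟨(0, 1), by decide⟩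
      exact ⟨x, fun h => absurd hp h⟩
    · obtain ⟨x, hx⟩ := hsurj ⟨p, hp⟩
      refine ⟨x, fun _ => ?_⟩
      have := congrArg Subtype.val hx
      exact ⟨congrArg Prod.fst this, congrArg Prod.snd this⟩
  choose g hg using hex
  have hgne : ∀ p ∈ offDiagCells, ∀ q ∈ offDiagCells, p ≠ q → g p ≠ g q := by
    intro p hp q hq hpq h
    have h1 := hg p (hcell p hp)
    have h2 := hg q (hcell q hq)
    rw [h] at h1
    exact hpq (Prod.ext (h1.1.symm.trans h2.1) (h1.2.symm.trans h2.2))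
  have hmem : ∀ a : Fin 5, a ≠ 0 → a ≠ 1 →
      offDiagCells.map (fun p => w (g p) a) ∈ frameFillings offDiagCells := by
    intro a h0 h1
    refine map_mem_frameFillings _ _ hnodup ?_ ?_
    · intro p hp
      rw [← (hg p (hcell p hp)).1]
      exact hfirst _ a h0
    · intro p hp q hq hpq hline heq
      have hp' := hg p (hcell p hp)
      have hq' := hg q (hcell q hq)
      rcases hline with h | h
      · exact hagree _ _ (hgne q hq p hp hpq.symm) a 0 h0 heq (by rw [hq'.1, hp'.1, h])
      · exact hagree _ _ (hgne q hq p hp hpq.symm) a 1 h1 heq (by rw [hq'.2, hp'.2, h])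
  have horth : ∀ a b : Fin 5, a ≠ b →
      ((offDiagCells.map fun p => w (g p) a).zip (offDiagCells.map fun p => w (g p) b)).Nodup := by
    intro a b hab
    rw [List.zip_map', List.nodup_map_iff_inj_on hnodup]
    intro p hp q hq hpq
    by_contra hne
    rw [Prod.mk.injEq] at hpq
    exact hagree _ _ (hgne p hp q hq hne) a b hab hpq.1 hpq.2
  exact frameFillings_no_orthogonal_triple _ (hmem 2 (by decide) (by decide))
    _ (hmem 3 (by decide) (by decide)) (horth 2 3 (by decide))
    _ (hmem 4 (by decide) (by decide)) (horth 2 4 (by decide)) (horth 3 4 (by decide))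

section Design

variable {V G : Type*} [Fintype V] [DecidableEq V] [DecidableEq G]

/-- In a group divisible design with block size four and a group `g` with twelve points outside
it, every point of `g` lies on four blocks. -/
theorem card_blocks_through (grp : V → G) (B : Finset (Finset V)) (g : G)
    (hcard : ∀ b ∈ B, b.card = 4)
    (hpair : ∀ x y, grp x ≠ grp y → ∃! b, b ∈ B ∧ x ∈ b ∧ y ∈ b)
    (hgrp : ∀ x y, x ≠ y → grp x = grp y → ∀ b ∈ B, x ∈ b → y ∉ b)
    (hout : (univ.filter fun x => grp x ≠ g).card = 12) (z : V) (hz : grp z = g) :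
    (B.filter fun b => z ∈ b).card = 4 := by
  have hunion : (univ.filter fun x => grp x ≠ g) =
      (B.filter fun b => z ∈ b).biUnion fun b => b.erase z := by
    ext x
    simp only [mem_filter, mem_univ, true_and, mem_biUnion, mem_erase]
    constructor
    · intro hx
      obtain ⟨b, ⟨hb, hxb, hzb⟩, -⟩ := hpair x z (by rwa [hz])
      exact ⟨b, ⟨hb, hzb⟩, fun h => hx (h ▸ hz), hxb⟩
    · rintro ⟨b, ⟨hb, hzb⟩, hxz, hxb⟩ hx
      exact hgrp z x (Ne.symm hxz) (hz.trans hx.symm) b hb hzb hxb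
  have hdisj : ∀ b ∈ B.filter (fun b => z ∈ b), ∀ b' ∈ B.filter (fun b => z ∈ b), b ≠ b' →
      Disjoint (b.erase z) (b'.erase z) := by
    intro b hb b' hb' hne
    rw [mem_filter] at hb hb'
    rw [Finset.disjoint_left]
    intro x hx hx'
    rw [mem_erase] at hx hx'
    have hxz : grp x ≠ grp z := fun h => hgrp x z hx.1 h b hb.1 hx.2 hb.2
    exact hne ((hpair x z hxz).unique ⟨hb.1, hx.2, hb.2⟩ ⟨hb'.1, hx'.2, hb'.2⟩)
  have hsum := card_biUnion hdisj
  rw [← hunion, hout, Finset.sum_const_nat (m := 3)] at hsum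
  · omega
  · intro b hb
    rw [mem_filter] at hb
    rw [card_erase_of_mem hb.2, hcard b hb.1]

/-- Under the hypotheses of `card_blocks_through`, for two points of the group `g`, each block on
the first point misses exactly one block on the second. -/
theorem existsUnique_disjoint_block (grp : V → G) (B : Finset (Finset V)) (g : G)
    (hcard : ∀ b ∈ B, b.card = 4)
    (hpair : ∀ x y, grp x ≠ grp y → ∃! b, b ∈ B ∧ x ∈ b ∧ y ∈ b)
    (hgrp : ∀ x y, x ≠ y → grp x = grp y → ∀ b ∈ B, x ∈ b → y ∉ b)
    (hout : (univ.filter fun x => grp x ≠ g).card = 12) (z z' : V) (hz : grp z = g)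
    (hz' : grp z' = g) (hzz' : z ≠ z') (b : Finset V) (hb : b ∈ B) (hzb : z ∈ b) :
    ∃! b', (b' ∈ B ∧ z' ∈ b') ∧ Disjoint b b' := by
  have hzb' : z' ∉ b := hgrp z z' hzz' (hz.trans hz'.symm) b hb hzb
  have hne : ∀ x ∈ b.erase z, grp x ≠ grp z' := by
    intro x hx h
    rw [mem_erase] at hx
    exact hgrp x z hx.1 (h.trans (hz'.trans hz.symm)) b hb hx.2 hzb
  have hmeet : ((B.filter fun b' => z' ∈ b').filter fun b' => ¬ Disjoint b b').card = 3 := by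
    have h3 : (b.erase z).card = 3 := by rw [card_erase_of_mem hzb, hcard b hb]
    rw [← h3]
    symm
    refine card_bij (fun x hx => (hpair x z' (hne x hx)).choose) ?_ ?_ ?_
    · intro x hx
      have h := (hpair x z' (hne x hx)).choose_spec.1
      rw [mem_filter, mem_filter]
      exact ⟨⟨h.1, h.2.2⟩, fun hd => Finset.disjoint_left.1 hd (mem_of_mem_erase hx) h.2.1⟩
    · intro x hx y hy hxy
      by_contra hxy'
      have h := (hpair x z' (hne x hx)).choose_spec.1
      have h' := (hpair y z' (hne y hy)).choose_spec.1
      rw [← hxy] at h'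
      have hg : grp x ≠ grp y := fun hg =>
        hgrp x y hxy' hg b hb (mem_of_mem_erase hx) (mem_of_mem_erase hy)
      have := (hpair x y hg).unique ⟨hb, mem_of_mem_erase hx, mem_of_mem_erase hy⟩
        ⟨h.1, h.2.1, h'.2.1⟩
      exact hzb' (this ▸ h.2.2)
    · intro b' hb'
      rw [mem_filter, mem_filter, Finset.not_disjoint_iff] at hb'
      obtain ⟨⟨hb'B, hz'b'⟩, x, hxb, hxb'⟩ := hb'
      have hx : x ∈ b.erase z := by
        refine mem_erase.2 ⟨?_, hxb⟩
        rintro rfl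
        exact hgrp x z' hzz' (hz.trans hz'.symm) b' hb'B hxb' hz'b'
      exact ⟨x, hx, (hpair x z' (hne x hx)).unique (hpair x z' (hne x hx)).choose_spec.1
        ⟨hb'B, hxb', hz'b'⟩⟩
  have htot := card_blocks_through grp B g hcard hpair hgrp hout z' hz'
  rw [← card_filter_add_card_filter_not (fun b' => Disjoint b b'), hmeet] at htot
  obtain ⟨b', hb'⟩ := card_eq_one.1 (show
    ((B.filter fun b' => z' ∈ b').filter fun b' => Disjoint b b').card = 1 by omega)
  have hiff : ∀ c, ((c ∈ B ∧ z' ∈ c) ∧ Disjoint b c) ↔ c = b' := by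
    intro c
    rw [← mem_singleton, ← hb', mem_filter, mem_filter]
  exact ⟨b', (hiff b').2 rfl, fun c hc => (hiff c).1 hc⟩

/-- No group divisible design with block size four has a group of size five with exactly twelve
points outside it. -/
theorem no_fourGDD_group_five (grp : V → G) (B : Finset (Finset V)) (g : G)
    (hcard : ∀ b ∈ B, b.card = 4)
    (hpair : ∀ x y, grp x ≠ grp y → ∃! b, b ∈ B ∧ x ∈ b ∧ y ∈ b)
    (hgrp : ∀ x y, x ≠ y → grp x = grp y → ∀ b ∈ B, x ∈ b → y ∉ b)
    (hin : (univ.filter fun x => grp x = g).card = 5)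
    (hout : (univ.filter fun x => grp x ≠ g).card = 12) : False := by
  let inf : Fin 5 → V := fun a => ((equivFinOfCardEq hin).symm a : V)
  have hinf : ∀ a, grp (inf a) = g := fun a =>
    (mem_filter.1 ((equivFinOfCardEq hin).symm a).2).2
  have hinj : Function.Injective inf := fun a b h =>
    (equivFinOfCardEq hin).symm.injective (Subtype.ext h)
  let X := {x // grp x ≠ g}
  have hX : Fintype.card X = 12 := by rw [Fintype.card_subtype, hout]
  have hblk : ∀ (x : X) (a : Fin 5), ∃ b, b ∈ B ∧ x.1 ∈ b ∧ inf a ∈ b := fun x a =>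
    (hpair x.1 (inf a) (by rw [hinf]; exact x.2)).exists
  choose blk hblkB hxblk hinfblk using hblk
  have hmiss : ∀ (x : X) (a : Fin 5), ∃ b, (b ∈ B ∧ inf 0 ∈ b) ∧
      (a = 0 → b = blk x 0) ∧ (a ≠ 0 → Disjoint (blk x a) b) := by
    intro x a
    by_cases ha : a = 0
    · exact ⟨blk x 0, ⟨hblkB x 0, hinfblk x 0⟩, fun _ => rfl, fun h => absurd ha h⟩
    · obtain ⟨b, hb, -⟩ := existsUnique_disjoint_block grp B g hcard hpair hgrp hout (inf a)
        (inf 0) (hinf a) (hinf 0) (fun h => ha (hinj h)) (blk x a) (hblkB x a) (hinfblk x a)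
      exact ⟨b, hb.1, fun h => absurd h ha, fun _ => hb.2⟩
  choose m hm hm0 hmd using hmiss
  have hblk_eq : ∀ x y a, m x a = m y a → blk x a = blk y a := by
    intro x y a h
    by_cases ha : a = 0
    · subst ha
      rw [← hm0 x 0 rfl, ← hm0 y 0 rfl, h]
    · refine (existsUnique_disjoint_block grp B g hcard hpair hgrp hout (inf 0)
        (inf a) (hinf 0) (hinf a) (fun h => ha (hinj h).symm) (m x a) (hm x a).1
        (hm x a).2).unique ⟨⟨hblkB x a, hinfblk x a⟩, (hmd x a ha).symm⟩
        ⟨⟨hblkB y a, hinfblk y a⟩, ?_⟩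
      rw [h]
      exact (hmd y a ha).symm
  let e := equivFinOfCardEq (card_blocks_through grp B g hcard hpair hgrp hout (inf 0) (hinf 0))
  have he : ∀ x a y b, e ⟨m x a, mem_filter.2 (hm x a)⟩ = e ⟨m y b, mem_filter.2 (hm y b)⟩ →
      m x a = m y b := fun x a y b h => congrArg Subtype.val (e.injective h)
  refine no_twelve_words hX (fun x a => e ⟨m x a, mem_filter.2 (hm x a)⟩) ?_ ?_
  · intro x a ha h
    have hd := hmd x a ha
    rw [he _ _ _ _ h, hm0 x 0 rfl] at hd
    exact Finset.disjoint_left.1 hd (hxblk x a) (hxblk x 0)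
  · intro x y hxy a b hab ha hb
    have ha' := hblk_eq x y a (he _ _ _ _ ha)
    have hb' := hblk_eq x y b (he _ _ _ _ hb)
    have hya : y.1 ∈ blk x a := ha' ▸ hxblk y a
    have hyb : y.1 ∈ blk x b := hb' ▸ hxblk y b
    have hg : grp x.1 ≠ grp y.1 := fun hg =>
      hgrp x.1 y.1 (fun h => hxy (Subtype.ext h)) hg _ (hblkB x a) (hxblk x a) hya
    have heq := (hpair x.1 y.1 hg).unique ⟨hblkB x a, hxblk x a, hya⟩ ⟨hblkB x b, hxblk x b, hyb⟩
    exact hgrp (inf a) (inf b) (fun h => hab (hinj h)) ((hinf a).trans (hinf b).symm) _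
      (hblkB x a) (hinfblk x a) (heq ▸ hinfblk x b)

end Design

/-- There is no 4-GDD of type `2^6 5^1`. -/
theorem no_fourGDD_2pow6_5 : ¬ IsGDD 4 (List.replicate 6 2 ++ [5]) := by
  rintro ⟨grp, B, -, hsize, hcard, hpair, hgrp⟩
  have hin := hsize ⟨6, by decide⟩
  refine no_fourGDD_group_five grp B ⟨6, by decide⟩ hcard hpair hgrp hin ?_
  have htot := card_filter_add_card_filter_not (s := univ)
    (fun x => grp x = (⟨6, by decide⟩ : Fin (List.replicate 6 2 ++ [5]).length))
  rw [hin, card_univ, Fintype.card_fin] at htot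
  exact Nat.add_left_cancel (htot : 5 + _ = 5 + 12)
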